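/- Assume either (a) d ≠ 0 and (s,ε) ∈ S[d], or (b) d = 0 and (s,ε) ∈ S (in case (b) read Y(s,ε) for Y(s,ε)[d]). Then the k-subspace Y(s,ε)[d] of k[V] is stable under the action of Sp(V), i.e., for every g ∈ Sp(V) and every h ∈ Y(s,ε)[d], the function v ↦ h(g⁻¹v) again lies in Y(s,ε)[d]. -/

import Mathlib

open scoped Classical

noncomputable section

/-- The `2m`-dimensional standard symplectic space over `k = F_q = GaloisField p t`:
pairs `(x,y)` of `m`-tuples; the coordinates are `x_i(v) = v.1 i`, `y_i(v) = v.2 i`. -/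
abbrev SympV (p t m : ℕ) [Fact p.Prime] : Type :=
  (Fin m → GaloisField p t) × (Fin m → GaloisField p t)

/-- The nonsingular alternating bilinear form
`⟨(x,y),(x',y')⟩ = Σ_i (x_i y'_i − y_i x'_i)`. -/
def sform {p t m : ℕ} [Fact p.Prime] (v w : SympV p t m) : GaloisField p t :=
  ∑ i, (v.1 i * w.2 i - v.2 i * w.1 i)

/-- Membership in the symplectic group `Sp(V)`: a linear automorphism of `V`
preserving the form. -/
def IsSymp {p t m : ℕ} [Fact p.Prime]
    (g : SympV p t m ≃ₗ[GaloisField p t] SympV p t m) : Prop :=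
  ∀ v w, sform (g v) (g w) = sform v w

/-- A `k`-subspace `M` of `k[V]` is `Sp(V)`-stable (a `kSp(V)`-submodule) if it is
closed under the action `(g·f)(v) = f(g⁻¹v)`. -/
def SpStable {p t m : ℕ} [Fact p.Prime]
    (M : Submodule (GaloisField p t) (SympV p t m → GaloisField p t)) : Prop :=
  ∀ g : SympV p t m ≃ₗ[GaloisField p t] SympV p t m, IsSymp g →
    ∀ h ∈ M, (fun v => h (g.symm v)) ∈ M

/-- The monomial `x^α y^β = ∏_i x_i^{α_i} y_i^{β_i}` as a function `V → k`. -/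
def mono {p t m : ℕ} [Fact p.Prime] (α β : Fin m → ℕ) :
    SympV p t m → GaloisField p t :=
  fun v => ∏ i, (v.1 i ^ α i * v.2 i ^ β i)

/-- The complementary multi-index `ᾱ = (p−1−α₁,…,p−1−α_m)`. -/
def abar (p : ℕ) {m : ℕ} (α : Fin m → ℕ) : Fin m → ℕ := fun i => p - 1 - α i

/-- `α! = ∏_i α_i!`, computed in the prime field `F_p ⊆ k`. -/
def factk (p t : ℕ) [Fact p.Prime] {m : ℕ} (α : Fin m → ℕ) : GaloisField p t :=
  ∏ i, ((α i).factorial : GaloisField p t)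

/-- Allowable `j`-th digit of a symplectic basis function, of degree `lam`;
`pl` records whether this digit counts towards the signature (a monomial
`x^α y^{ᾱ}` or a '+' binomial when `lam = m(p−1)`). -/
def IsDigit (p t m lam : ℕ) [Fact p.Prime] (pl : Prop)
    (g : SympV p t m → GaloisField p t) : Prop :=
  (lam ≠ m * (p - 1) ∧ ¬pl ∧
    ∃ α β : Fin m → ℕ, (∀ i, α i ≤ p - 1) ∧ (∀ i, β i ≤ p - 1) ∧
      (∑ i, α i) + (∑ i, β i) = lam ∧ g = mono α β) ∨
  (lam = m * (p - 1) ∧ pl ∧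
    ∃ α : Fin m → ℕ, (∀ i, α i ≤ p - 1) ∧ g = mono α (abar p α)) ∨
  (lam = m * (p - 1) ∧
    ∃ α β : Fin m → ℕ, (∀ i, α i ≤ p - 1) ∧ (∀ i, β i ≤ p - 1) ∧
      (∑ i, α i) + (∑ i, β i) = m * (p - 1) ∧ β ≠ abar p α ∧
      g = mono α β +
        ((if pl then (1 : GaloisField p t) else -1) *
          ((-1) ^ ((∑ i, β i) + m) * factk p t α * factk p t β)) •
            mono (abar p β) (abar p α))

/-- `f` is a symplectic basis function of type `λ` with signature `ε`:
`f = f₀·f₁^p⋯f_{t−1}^{p^{t−1}}` with every digit `f_j` allowable of degree `λ_j`,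
and `ε` is the set of digits of '+' kind. -/
def IsSBF (p t m : ℕ) [Fact p.Prime] (lam : Fin t → ℕ) (eps : Finset (Fin t))
    (f : SympV p t m → GaloisField p t) : Prop :=
  ∃ g : Fin t → (SympV p t m → GaloisField p t),
    (∀ j, IsDigit p t m (lam j) (j ∈ eps) (g j)) ∧
    f = fun v => ∏ j, (g j v) ^ (p ^ (j : ℕ))

/-- The `j`-th `p`-adic digit of `d`. -/
def digitp (p d j : ℕ) : ℕ := d / p ^ j % p

/-- The type `λ` attached to a tuple `s` (for `d`): `λ_j = p·s_{j+1} − s_j + d_j`,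
indices mod `t`. -/
def lamOf (p t d : ℕ) [NeZero t] (s : Fin t → ℤ) (j : Fin t) : ℤ :=
  (p : ℤ) * s (j + 1) - s j + digitp p d (j : ℕ)

/-- The type of `s` as a tuple of naturals. -/
def lamOfN (p t d : ℕ) [NeZero t] (s : Fin t → ℤ) (j : Fin t) : ℕ :=
  (lamOf p t d s j).toNat

/-- Membership in `H[d]`: `0 ≤ s_j ≤ 2m−1` and `0 ≤ λ_j ≤ 2m(p−1)` for all `j`. -/
def memHd (p t m d : ℕ) [NeZero t] (s : Fin t → ℤ) : Prop :=
  (∀ j, 0 ≤ s j ∧ s j ≤ 2 * m - 1) ∧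
  (∀ j, 0 ≤ lamOf p t d s j ∧ lamOf p t d s j ≤ 2 * m * ((p : ℤ) - 1))

/-- Membership in `H`: `1 ≤ s_j ≤ 2m−1` and `0 ≤ p·s_{j+1} − s_j ≤ 2m(p−1)`. -/
def memH (p t m : ℕ) [NeZero t] (s : Fin t → ℤ) : Prop :=
  (∀ j, 1 ≤ s j ∧ s j ≤ 2 * m - 1) ∧
  (∀ j, 0 ≤ lamOf p t 0 s j ∧ lamOf p t 0 s j ≤ 2 * m * ((p : ℤ) - 1))

/-- `J(s) = {j : λ_j = m(p−1)}`. -/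
def Jset (p t m d : ℕ) [NeZero t] (s : Fin t → ℤ) : Finset (Fin t) :=
  Finset.univ.filter (fun j => lamOf p t d s j = m * ((p : ℤ) - 1))

/-- Membership in `S[d]`: `s ∈ H[d]` and `ε ⊆ J(s)`. -/
def memSd (p t m d : ℕ) [NeZero t] (s : Fin t → ℤ) (eps : Finset (Fin t)) : Prop :=
  memHd p t m d s ∧ eps ⊆ Jset p t m d s

/-- Membership in `S`: `s ∈ H` and `ε ⊆ J(s)` (with `d = 0`). -/
def memS (p t m : ℕ) [NeZero t] (s : Fin t → ℤ) (eps : Finset (Fin t)) : Prop :=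
  memH p t m s ∧ eps ⊆ Jset p t m 0 s

/-- Case distinction: for `d ≠ 0` the relevant poset is `S[d]`, for `d = 0` it is `S`. -/
def memCase (p t m d : ℕ) [NeZero t] (s : Fin t → ℤ) (eps : Finset (Fin t)) : Prop :=
  if d = 0 then memS p t m s eps else memSd p t m d s eps

/-- `Z(s',s) = {j : s'_j = s_j, s'_{j+1} = s_{j+1}, λ'_j = m(p−1)}`. -/
def Zset (p t m d : ℕ) [NeZero t] (s' s : Fin t → ℤ) : Finset (Fin t) :=
  Finset.univ.filter (fun j =>
    s' j = s j ∧ s' (j + 1) = s (j + 1) ∧ lamOf p t d s' j = m * ((p : ℤ) - 1))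

/-- The order on `S[d]` (and on `S`): `(s',ε') ≤ (s,ε)` iff `s' ≤ s` pointwise and
`ε ∩ Z(s',s) = ε' ∩ Z(s',s)`. -/
def leSd (p t m d : ℕ) [NeZero t] (s' : Fin t → ℤ) (eps' : Finset (Fin t))
    (s : Fin t → ℤ) (eps : Finset (Fin t)) : Prop :=
  (∀ j, s' j ≤ s j) ∧ eps ∩ Zset p t m d s' s = eps' ∩ Zset p t m d s' s

/-- `Y(s,ε)[d]` (for `d ≠ 0`), resp. `Y(s,ε)` (for `d = 0`): the span in `k[V]` of all
symplectic basis functions with signed `H`-type `(s',ε') ≤ (s,ε)` in `S[d]`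
(resp. in `S`). -/
def Ymod (p t m d : ℕ) [Fact p.Prime] [NeZero t] (s : Fin t → ℤ)
    (eps : Finset (Fin t)) :
    Submodule (GaloisField p t) (SympV p t m → GaloisField p t) :=
  Submodule.span (GaloisField p t)
    {f | ∃ s' eps', memCase p t m d s' eps' ∧ leSd p t m d s' eps' s eps ∧
      IsSBF p t m (lamOfN p t d s') eps' f}

/-- `Y_<(s,ε)[d]`: the span of the symplectic basis functions with signed `H`-type
strictly below `(s,ε)`. -/
def Yltmod (p t m d : ℕ) [Fact p.Prime] [NeZero t] (s : Fin t → ℤ)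
    (eps : Finset (Fin t)) :
    Submodule (GaloisField p t) (SympV p t m → GaloisField p t) :=
  Submodule.span (GaloisField p t)
    {f | ∃ s' eps', memCase p t m d s' eps' ∧ leSd p t m d s' eps' s eps ∧
      ¬(s' = s ∧ eps' = eps) ∧ IsSBF p t m (lamOfN p t d s') eps' f}

namespace YSp

open MvPolynomial

section alg

variable {k : Type*} [Field k] {m : ℕ}

/-- polynomials in the `2m` coordinates -/
abbrev Pol (k : Type*) [Field k] (m : ℕ) : Type _ := MvPolynomial (Fin m ⊕ Fin m) k

/-- sign attached to a coordinate -/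
def sg (k : Type*) [Field k] {m : ℕ} : Fin m ⊕ Fin m → k := Sum.elim (fun _ => 1) (fun _ => -1)

/-- the derivation dual to a coordinate under the symplectic form -/
def Dd (i : Fin m ⊕ Fin m) : Derivation k (Pol k m) (Pol k m) := sg k i • pderiv i.swap

/-- the ideal of `p`-th powers -/
def Ip (k : Type*) [Field k] (m p : ℕ) : Ideal (Pol k m) :=
  Ideal.span ((fun e => monomial e (1 : k)) '' Set.range (fun i => Finsupp.single i p))

def tcoef (k : Type*) [Field k] {m : ℕ} (e : (Fin m ⊕ Fin m) →₀ ℕ) : k :=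
  (-1) ^ (m + ∑ i, e (Sum.inl i)) * ∏ i, ((e i).factorial : k)

def tflip (p : ℕ) {m : ℕ} (e : (Fin m ⊕ Fin m) →₀ ℕ) : (Fin m ⊕ Fin m) →₀ ℕ :=
  Finsupp.equivFunOnFinite.symm (fun i => p - 1 - e i.swap)

/-- the duality operator -/
def Tt (k : Type*) [Field k] (m p : ℕ) : Pol k m →ₗ[k] Pol k m :=
  (basisMonomials (Fin m ⊕ Fin m) k).constr k (fun e => monomial (tflip p e) (tcoef k e))

lemma Tt_monomial (p : ℕ) (e : (Fin m ⊕ Fin m) →₀ ℕ) :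
    Tt k m p (monomial e 1) = monomial (tflip p e) (tcoef k e) := by
  have := (basisMonomials (Fin m ⊕ Fin m) k).constr_basis k
    (fun e => monomial (tflip p e) (tcoef k e)) e
  rwa [coe_basisMonomials] at this

lemma tflip_apply (p : ℕ) (e : (Fin m ⊕ Fin m) →₀ ℕ) (i) : tflip p e i = p - 1 - e i.swap := rfl

lemma fact_eq_zero {p : ℕ} [Fact p.Prime] [CharP k p] {n : ℕ} (h : p ≤ n) :
    (n.factorial : k) = 0 := by
  rw [CharP.cast_eq_zero_iff k p]
  exact (Nat.Prime.dvd_factorial Fact.out).2 h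

lemma tcoef_eq_zero {p : ℕ} [Fact p.Prime] [CharP k p] {e : (Fin m ⊕ Fin m) →₀ ℕ} {i}
    (h : p ≤ e i) : tcoef k e = 0 := by
  unfold tcoef
  rw [Finset.prod_eq_zero (Finset.mem_univ i) (fact_eq_zero h), mul_zero]

lemma tcoef_add_single {p : ℕ} [Fact p.Prime] [CharP k p] (e : (Fin m ⊕ Fin m) →₀ ℕ) (i) :
    tcoef k (e + Finsupp.single i 1) = sg k i * (tcoef k e * ((p - 1 - e i : ℕ) : k)) := by
  by_cases h : p ≤ e i
  · rw [tcoef_eq_zero (p := p) (i := i) (by simp; omega), tcoef_eq_zero (p := p) h]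
    simp
  · push Not at h
    have h1 : ((p - 1 - e i : ℕ) : k) = -((e i : k) + 1) := by
      have : ((p - 1 - e i : ℕ) : k) + ((e i : k) + 1) = 0 := by
        have h0 : ((p - 1 - e i + (e i + 1) : ℕ) : k) = 0 := by
          rw [show p - 1 - e i + (e i + 1) = p by omega]
          simp
        simpa only [Nat.cast_add, Nat.cast_one] using h0
      linear_combination this
    have h2 : ∏ j, (((e + Finsupp.single i 1 : (Fin m ⊕ Fin m) →₀ ℕ) j).factorial : k)
        = ((e i : k) + 1) * ∏ j, ((e j).factorial : k) := by
      rw [← Finset.mul_prod_erase Finset.univ _ (Finset.mem_univ i),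
        ← Finset.mul_prod_erase Finset.univ (fun j => ((e j).factorial : k)) (Finset.mem_univ i)]
      rw [← mul_assoc]
      congr 1
      · simp [Nat.factorial_succ]
      · apply Finset.prod_congr rfl
        intro j hj
        have : j ≠ i := Finset.ne_of_mem_erase hj
        simp [this.symm]
    unfold tcoef
    rw [h1, h2]
    cases i with
    | inl a =>
      have h3 : ∑ i, (e + Finsupp.single (Sum.inl a) 1 : (Fin m ⊕ Fin m) →₀ ℕ) (Sum.inl i)
        = (∑ i, e (Sum.inl i)) + 1 := by
        simp [Finsupp.single_apply, Finset.sum_add_distrib]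
      rw [h3]
      simp only [sg, Sum.elim_inl]
      ring
    | inr a =>
      have h3 : ∑ i, (e + Finsupp.single (Sum.inr a) 1 : (Fin m ⊕ Fin m) →₀ ℕ) (Sum.inl i)
        = (∑ i, e (Sum.inl i)) := by
        simp [Finsupp.single_apply]
      rw [h3]
      simp only [sg, Sum.elim_inr]
      ring

lemma Tt_X_mul {p : ℕ} [Fact p.Prime] [CharP k p] (i : Fin m ⊕ Fin m) (F : Pol k m) :
    Tt k m p (X i * F) = Dd i (Tt k m p F) := by
  have key : (Tt k m p) ∘ₗ (LinearMap.mulLeft k (X i : Pol k m))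
      = (Dd i : Derivation k (Pol k m) (Pol k m)).toLinearMap ∘ₗ Tt k m p := by
    apply (basisMonomials (Fin m ⊕ Fin m) k).ext
    intro e
    simp only [coe_basisMonomials, LinearMap.comp_apply, LinearMap.mulLeft_apply]
    rw [Tt_monomial]
    have : (X i : Pol k m) * monomial e 1 = monomial (e + Finsupp.single i 1) 1 := by
      rw [X, monomial_mul, add_comm, mul_one]
    rw [this, Tt_monomial]
    change _ = Dd i _
    simp only [Dd, Derivation.smul_apply, pderiv_monomial, smul_monomial]
    rw [tcoef_add_single (p := p)]
    have h1 : tflip p (e + Finsupp.single i 1) = tflip p e - Finsupp.single i.swap 1 := by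
      ext j
      simp only [tflip_apply, Finsupp.coe_add, Finsupp.coe_tsub, Pi.add_apply, Pi.sub_apply,
        Finsupp.single_apply]
      have : (i = j.swap) ↔ (i.swap = j) := by
        constructor
        · rintro rfl; simp
        · rintro rfl; simp
      simp only [this]
      split_ifs <;> omega
    rw [h1, tflip_apply, Sum.swap_swap, smul_eq_mul]
  exact LinearMap.congr_fun key F

/-- linear substitution -/
def act (A : Matrix (Fin m ⊕ Fin m) (Fin m ⊕ Fin m) k) : Pol k m →ₐ[k] Pol k m :=
  aeval (fun l => ∑ j, C (A l j) * X j)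

lemma act_X (A : Matrix (Fin m ⊕ Fin m) (Fin m ⊕ Fin m) k) (l) :
    act A (X l) = ∑ j, C (A l j) * X j := by simp [act]

lemma act_C (A : Matrix (Fin m ⊕ Fin m) (Fin m ⊕ Fin m) k) (c) :
    act A (C c) = C c := by simp [act, algebraMap_eq]

lemma act_mul (A B : Matrix (Fin m ⊕ Fin m) (Fin m ⊕ Fin m) k) (F) :
    act (A * B) F = act B (act A F) := by
  have : act (A * B) = (act B).comp (act A) := by
    apply MvPolynomial.algHom_ext
    intro l
    simp only [AlgHom.comp_apply, act_X, map_sum, map_mul, act_C, Matrix.mul_apply]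
    simp only [Finset.sum_mul, Finset.mul_sum]
    rw [Finset.sum_comm]
    simp [mul_assoc]
  rw [this]; rfl

lemma Xp_mem (p : ℕ) (i) : (X i : Pol k m) ^ p ∈ Ip k m p := by
  rw [X_pow_eq_monomial]
  exact Ideal.subset_span ⟨_, ⟨i, rfl⟩, rfl⟩

lemma Ip_induction {p : ℕ} {M : Pol k m → Prop} (h0 : M 0)
    (hadd : ∀ a b, M a → M b → M (a + b)) (hx : ∀ a i, M (a * X i ^ p)) :
    ∀ F ∈ Ip k m p, M F := by
  intro F hF
  suffices h : ∀ a, M (a * F) by simpa using h 1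
  refine Submodule.span_induction (p := fun F _ => ∀ a, M (a * F)) ?_ ?_ ?_ ?_ hF
  · rintro _ ⟨_, ⟨i, rfl⟩, rfl⟩ a
    have := hx a i
    rwa [X_pow_eq_monomial] at this
  · simpa using h0
  · intro x y _ _ h1 h2 a
    rw [mul_add]; exact hadd _ _ (h1 a) (h2 a)
  · intro b x _ h a
    rw [smul_eq_mul, ← mul_assoc]; exact h _

lemma Dd_mem {p : ℕ} [Fact p.Prime] [CharP k p] (i) (F : Pol k m) (hF : F ∈ Ip k m p) :
    Dd i F ∈ Ip k m p := by
  revert F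
  apply Ip_induction
  · simp
  · intro a b ha hb; rw [map_add]; exact add_mem ha hb
  · intro a j
    have : (p : Pol k m) = 0 := by
      rw [← map_natCast (C : k →+* Pol k m)]; simp
    rw [Derivation.leibniz, Derivation.leibniz_pow]
    apply add_mem
    · rw [nsmul_eq_mul, this, zero_mul, smul_zero]; exact zero_mem _
    · rw [smul_eq_mul]; exact Ideal.mul_mem_right _ _ (Xp_mem p j)

lemma act_mem {p : ℕ} [Fact p.Prime] [CharP k p] (A : Matrix (Fin m ⊕ Fin m) (Fin m ⊕ Fin m) k)
    (F : Pol k m) (hF : F ∈ Ip k m p) : act A F ∈ Ip k m p := by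
  revert F
  apply Ip_induction
  · simp
  · intro a b ha hb; rw [map_add]; exact add_mem ha hb
  · intro a j
    rw [map_mul, map_pow, act_X, sum_pow_char]
    apply Ideal.mul_mem_left
    apply Ideal.sum_mem
    intro l _
    rw [mul_pow]
    exact Ideal.mul_mem_left _ _ (Xp_mem p l)

/-- top monomial -/
def tau (k : Type*) [Field k] (m p : ℕ) : Pol k m := ∏ i, X i ^ (p - 1)

lemma act_tau {p : ℕ} [Fact p.Prime] [CharP k p]
    (A : Matrix (Fin m ⊕ Fin m) (Fin m ⊕ Fin m) k) (hA : A.det ≠ 0) :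
    act A (tau k m p) - C (A.det ^ (p - 1)) * tau k m p ∈ Ip k m p := by
  refine Matrix.diagonal_transvection_induction_of_det_ne_zero
    (P := fun A => act A (tau k m p) - C (A.det ^ (p - 1)) * tau k m p ∈ Ip k m p) A hA
    ?_ ?_ ?_
  · intro D _
    have : act (Matrix.diagonal D) (tau k m p) =
        C ((Matrix.diagonal D).det ^ (p - 1)) * tau k m p := by
      have h : ∀ l, act (Matrix.diagonal D) (X l) = C (D l) * X l := by
        intro l
        rw [act_X, Finset.sum_eq_single l]
        · simp
        · intro j _ hj; simp [Matrix.diagonal_apply_ne' D hj]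
        · simp
      simp only [tau, map_prod, map_pow, h, mul_pow, Finset.prod_mul_distrib, Matrix.det_diagonal,
        Finset.prod_pow]
    rw [this, sub_self]; exact zero_mem _
  · intro t
    obtain ⟨i, j, hij, c⟩ := t
    simp only [Matrix.TransvectionStruct.toMatrix_mk, Matrix.det_transvection_of_ne _ _ hij,
      one_pow, C_1, one_mul]
    have h : ∀ l, act (Matrix.transvection i j c) (X l) =
        X l + if l = i then C c * X j else 0 := by
      intro l
      rw [act_X]
      simp only [Matrix.transvection, Matrix.add_apply, C_add, add_mul, Finset.sum_add_distrib]
      congr 1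
      · simp [Matrix.one_apply]
      · by_cases hl : l = i
        · subst hl
          rw [Finset.sum_eq_single j]
          · simp
          · intro b _ hb; simp [hb.symm]
          · simp
        · simp [hl, Ne.symm hl]
    simp only [tau, map_prod, map_pow, h]
    rw [← Finset.mul_prod_erase Finset.univ _ (Finset.mem_univ i),
      ← Finset.mul_prod_erase Finset.univ (fun l => (X l : Pol k m) ^ (p - 1)) (Finset.mem_univ i)]
    have e1 : ∏ x ∈ Finset.univ.erase i, ((X x : Pol k m) + if x = i then C c * X j else 0) ^ (p - 1)
        = ∏ x ∈ Finset.univ.erase i, (X x : Pol k m) ^ (p - 1) := by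
      apply Finset.prod_congr rfl
      intro x hx
      simp [Finset.ne_of_mem_erase hx]
    rw [e1, ← sub_mul, if_pos rfl, ← Finset.mul_prod_erase (Finset.univ.erase i) _
      (Finset.mem_erase.2 ⟨hij.symm, Finset.mem_univ j⟩)]
    obtain ⟨r, hr⟩ := sub_dvd_pow_sub_pow ((X i : Pol k m) + C c * X j) (X i) (p - 1)
    rw [hr]
    have : ((X i : Pol k m) + C c * X j - X i) * r *
        (X j ^ (p - 1) * ∏ x ∈ (Finset.univ.erase i).erase j, X x ^ (p - 1))
        = (C c * r * ∏ x ∈ (Finset.univ.erase i).erase j, X x ^ (p - 1)) * X j ^ (p - 1 + 1) := by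
      ring
    rw [this, Nat.sub_add_cancel (Fact.out : p.Prime).one_le]
    exact Ideal.mul_mem_left _ _ (Xp_mem p j)
  · intro A B _ _ iA iB
    have h1 := act_mem B _ iA
    have h2 := Ideal.mul_mem_left _ (C (A.det ^ (p - 1))) iB
    have := add_mem h1 h2
    rw [map_sub, map_mul, act_C] at this
    rw [act_mul, Matrix.det_mul, mul_pow, C_mul]
    convert! this using 1
    ring

lemma Tt_one {p : ℕ} : Tt k m p 1 = C ((-1) ^ m) * tau k m p := by
  have : (1 : Pol k m) = monomial 0 1 := rfl
  rw [this, Tt_monomial]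
  rw [tau, monomial_eq]
  simp [tcoef, tflip, Finsupp.prod_fintype]

lemma Dd_X (i l : Fin m ⊕ Fin m) :
    Dd i (X l : Pol k m) = C (- Matrix.J (Fin m) k i l) := by
  simp only [Dd, Derivation.smul_apply, pderiv_X, Matrix.J]
  rcases i with i | i <;> rcases l with l | l <;>
    simp [sg, Pi.single_apply, Matrix.one_apply, eq_comm] <;> split_ifs <;> simp

lemma Dd_act (A : Matrix (Fin m ⊕ Fin m) (Fin m ⊕ Fin m) k) (hA : A ∈ Matrix.symplecticGroup (Fin m) k)
    (i) (F : Pol k m) : ∑ j, C (A i j) * Dd j (act A F) = act A (Dd i F) := by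
  induction F using MvPolynomial.induction_on with
  | C a =>
    have : ∀ j, Dd j (C a : Pol k m) = 0 := fun j => by
      rw [← algebraMap_eq]; exact Derivation.map_algebraMap _ _
    simp [act_C, this]
  | add F G hF hG => simp only [map_add, mul_add, Finset.sum_add_distrib, hF, hG]
  | mul_X F l hF =>
    have h1 : ∑ j, C (A i j) * Dd j (act A (X l)) = C (- Matrix.J (Fin m) k i l) := by
      rw [SymplecticGroup.mem_iff] at hA
      rw [← hA]
      simp only [act_X, map_sum, Derivation.leibniz, Dd_X]
      have : ∀ j l, Dd j (C l : Pol k m) = 0 := fun j l => by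
        rw [← algebraMap_eq]; exact Derivation.map_algebraMap _ _
      simp only [this, mul_zero, add_zero, smul_eq_mul, ← C_mul, Matrix.mul_apply,
        Matrix.transpose_apply]
      simp only [← map_sum, ← C_mul]
      congr 1
      simp only [Finset.sum_mul, Finset.mul_sum]
      rw [Finset.sum_comm, ← Finset.sum_neg_distrib]
      apply Finset.sum_congr rfl; intro x _
      rw [← Finset.sum_neg_distrib]
      apply Finset.sum_congr rfl; intro y _
      ring
    simp only [map_mul, Derivation.leibniz, map_add, smul_eq_mul, ← hF]
    rw [Dd_X, act_C, ← h1]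
    simp only [Finset.mul_sum, ← Finset.sum_add_distrib]
    apply Finset.sum_congr rfl; intro y _
    ring

lemma Tt_act {p : ℕ} [Fact p.Prime] [CharP k p]
    (A : Matrix (Fin m ⊕ Fin m) (Fin m ⊕ Fin m) k) (hA : A ∈ Matrix.symplecticGroup (Fin m) k)
    (F : Pol k m) : Tt k m p (act A F) - act A (Tt k m p F) ∈ Ip k m p := by
  have hdet : A.det = 1 := SymplecticGroup.det_eq_one hA
  induction F using MvPolynomial.induction_on with
  | C a =>
    have := act_tau (p := p) A (by rw [hdet]; exact one_ne_zero)
    rw [hdet, one_pow, C_1, one_mul] at this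
    have h := Ideal.mul_mem_left _ (C (-(a * (-1) ^ m))) this
    have e : (C a : Pol k m) = a • 1 := by rw [smul_eq_C_mul, mul_one]
    rw [act_C, e, map_smul, Tt_one, map_smul, map_mul, act_C, smul_eq_C_mul, smul_eq_C_mul]
    convert! h using 1
    simp only [C_neg, C_mul]
    ring
  | add F G hF hG =>
    simp only [map_add]
    convert! add_mem hF hG using 1
    ring
  | mul_X F l hF =>
    rw [mul_comm F, map_mul, act_X, Finset.sum_mul, map_sum, Tt_X_mul, ← Dd_act A hA,
      ← Finset.sum_sub_distrib]
    apply Ideal.sum_mem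
    intro j _
    rw [mul_assoc, ← smul_eq_C_mul, map_smul, Tt_X_mul, smul_eq_C_mul, ← mul_sub, ← map_sub]
    exact Ideal.mul_mem_left _ _ (Dd_mem j _ hF)

end alg

end YSp

namespace YSp

open MvPolynomial

section dig

variable {k : Type*} [Field k] {m : ℕ}

lemma wilson_aux {p : ℕ} [Fact p.Prime] [CharP k p] (a : ℕ) (ha : a ≤ p - 1) :
    (a.factorial : k) * ((p - 1 - a).factorial : k) = (-1) ^ (a + 1) := by
  induction a with
  | zero =>
    have h := ZMod.wilsons_lemma p
    have h2 := congrArg (ZMod.castHom (dvd_refl p) k) h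
    simp only [map_natCast, map_neg, map_one] at h2
    simpa using h2
  | succ a ih =>
    have ih := ih (by omega)
    obtain ⟨b, hb⟩ : ∃ b, p - 1 - a = b + 1 := ⟨p - 1 - a - 1, by omega⟩
    rw [hb, Nat.factorial_succ] at ih
    rw [show p - 1 - (a + 1) = b by omega, Nat.factorial_succ]
    have h0 : ((a + 1 + (b + 1) : ℕ) : k) = 0 := by
      rw [show a + 1 + (b + 1) = p by have := (Fact.out : p.Prime).one_le; omega]
      simp
    push_cast at *
    rw [pow_succ, ← ih]
    linear_combination (a.factorial : k) * (b.factorial : k) * h0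

lemma sum_swap_aux (f : Fin m ⊕ Fin m → ℕ) : ∑ i, f (Sum.swap i) = ∑ i, f i := by
  simp [Fintype.sum_sum_type, add_comm]

lemma tcoef_mul {p : ℕ} [Fact p.Prime] [CharP k p] (hodd : Odd p) (e : (Fin m ⊕ Fin m) →₀ ℕ)
    (he : ∀ i, e i ≤ p - 1) : tcoef k e * tcoef k (tflip p e) = 1 := by
  have h1 : (∏ i, ((e i).factorial : k)) * ∏ i, ((tflip p e i).factorial : k)
      = (-1) ^ (∑ i, (e i + 1)) := by
    have : ∏ i, ((tflip p e i).factorial : k) = ∏ i, ((p - 1 - e i).factorial : k) := by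
      simp only [tflip_apply, Fintype.prod_sum_type, Sum.swap_inl, Sum.swap_inr]
      rw [mul_comm]
    rw [this, ← Finset.prod_mul_distrib, ← Finset.prod_pow_eq_pow_sum]
    exact Finset.prod_congr rfl fun i _ => wilson_aux _ (he i)
  have h2 : tcoef k e * tcoef k (tflip p e) = (-1) ^ ((m + ∑ i, e (Sum.inl i)) +
      (m + ∑ i, tflip p e (Sum.inl i)) + ∑ i, (e i + 1)) := by
    rw [pow_add, pow_add, ← h1]
    unfold tcoef
    ring
  rw [h2]
  apply Even.neg_one_pow
  have h3 : ∑ i, tflip p e (Sum.inl i) + ∑ i, e (Sum.inr i) = m * (p - 1) := by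
    rw [← Finset.sum_add_distrib]
    simp only [tflip_apply, Sum.swap_inl]
    rw [Finset.sum_congr rfl (fun i _ => Nat.sub_add_cancel (he (Sum.inr i)))]
    simp
  have h4 : ∑ i, (e i + 1) = ∑ i, e (Sum.inl i) + ∑ i, e (Sum.inr i) + (m + m) := by
    rw [Finset.sum_add_distrib, Fintype.sum_sum_type]
    simp
  obtain ⟨r, hr⟩ := hodd
  rw [h4]
  have h5 : m * (p - 1) = 2 * (m * r) := by rw [hr, Nat.add_sub_cancel]; ring
  rw [Nat.even_iff]
  omega

lemma tcoef_self {p : ℕ} [Fact p.Prime] [CharP k p] (e : (Fin m ⊕ Fin m) →₀ ℕ)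
    (he : ∀ i, e i ≤ p - 1) (h : ∀ i, e (Sum.inr i) = p - 1 - e (Sum.inl i)) :
    tcoef k e = 1 := by
  unfold tcoef
  rw [Fintype.prod_sum_type, ← Finset.prod_mul_distrib]
  have : ∏ i, ((e (Sum.inl i)).factorial : k) * ((e (Sum.inr i)).factorial : k)
      = (-1) ^ (∑ i, (e (Sum.inl i) + 1)) := by
    rw [← Finset.prod_pow_eq_pow_sum]
    apply Finset.prod_congr rfl
    intro i _
    rw [h, wilson_aux _ (he _)]
  rw [this, ← pow_add]
  apply Even.neg_one_pow
  rw [Finset.sum_add_distrib]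
  simp only [Finset.sum_const, Finset.card_univ, Fintype.card_fin, smul_eq_mul, mul_one]
  exact ⟨m + ∑ i, e (Sum.inl i), by ring⟩

lemma tflip_self {p : ℕ} (e : (Fin m ⊕ Fin m) →₀ ℕ)
    (he : ∀ i, e i ≤ p - 1) (h : ∀ i, e (Sum.inr i) = p - 1 - e (Sum.inl i)) :
    tflip p e = e := by
  ext i
  rw [tflip_apply]
  rcases i with i | i
  · have := h i; have := he (Sum.inl i); simp; omega
  · simp [h i]

lemma tflip_tflip {p : ℕ} (e : (Fin m ⊕ Fin m) →₀ ℕ)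
    (he : ∀ i, e i ≤ p - 1) : tflip p (tflip p e) = e := by
  ext i
  rw [tflip_apply, tflip_apply, Sum.swap_swap]
  have := he i; omega

lemma degree_tflip {p : ℕ} (e : (Fin m ⊕ Fin m) →₀ ℕ)
    (he : ∀ i, e i ≤ p - 1) : (tflip p e).degree + e.degree = 2 * (m * (p - 1)) := by
  rw [Finsupp.degree_eq_sum, Finsupp.degree_eq_sum, ← sum_swap_aux (fun i => e i),
    ← Finset.sum_add_distrib]
  simp only [tflip_apply]
  rw [Finset.sum_congr rfl (fun i _ => Nat.sub_add_cancel (he (Sum.swap i)))]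
  simp
  ring

lemma Tt_Tt {p : ℕ} [Fact p.Prime] [CharP k p] (hodd : Odd p) (e : (Fin m ⊕ Fin m) →₀ ℕ)
    (he : ∀ i, e i ≤ p - 1) : Tt k m p (Tt k m p (monomial e 1)) = monomial e 1 := by
  rw [Tt_monomial]
  have : monomial (tflip p e) (tcoef k e) = tcoef k e • monomial (tflip p e) (1 : k) := by
    rw [smul_monomial, smul_eq_mul, mul_one]
  rw [this, map_smul, Tt_monomial, smul_monomial, smul_eq_mul, tcoef_mul hodd e he,
    tflip_tflip e he]

end dig

section gal

variable {p t m : ℕ} [Fact p.Prime]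

/-- polynomial functions -/
def ev (G : Pol (GaloisField p t) m) (v : SympV p t m) : GaloisField p t :=
  eval (Sum.elim v.1 v.2) G

def sgn (p t : ℕ) [Fact p.Prime] (pl : Prop) : GaloisField p t := if pl then 1 else -1

lemma sgn_mul (pl : Prop) : sgn p t pl * sgn p t pl = 1 := by
  unfold sgn; split_ifs <;> simp

lemma ev_monomial (e : (Fin m ⊕ Fin m) →₀ ℕ) :
    ev (monomial e (1 : GaloisField p t))
      = mono (fun i => e (Sum.inl i)) (fun i => e (Sum.inr i)) := by
  funext v
  simp [ev, mono, eval_monomial, Finsupp.prod_fintype, Finset.prod_mul_distrib]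

lemma ev_add (F G : Pol (GaloisField p t) m) : ev (F + G) = ev F + ev G := by
  funext v; simp [ev]

lemma ev_smul (c : GaloisField p t) (G : Pol (GaloisField p t) m) : ev (c • G) = c • ev G := by
  funext v; simp [ev, smul_eval]

def ex (α β : Fin m → ℕ) : (Fin m ⊕ Fin m) →₀ ℕ := Finsupp.equivFunOnFinite.symm (Sum.elim α β)

lemma ex_inl (α β : Fin m → ℕ) (i) : ex α β (Sum.inl i) = α i := rfl
lemma ex_inr (α β : Fin m → ℕ) (i) : ex α β (Sum.inr i) = β i := rfl

lemma degree_sum (e : (Fin m ⊕ Fin m) →₀ ℕ) :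
    e.degree = ∑ i, e (Sum.inl i) + ∑ i, e (Sum.inr i) := by
  rw [Finsupp.degree_eq_sum, Fintype.sum_sum_type]

lemma ev_ex (α β : Fin m → ℕ) : ev (monomial (ex α β) (1 : GaloisField p t)) = mono α β := by
  rw [ev_monomial]; rfl

lemma tcoef_eq (hodd : Odd p) (e : (Fin m ⊕ Fin m) →₀ ℕ) (hdeg : e.degree = m * (p - 1)) :
    tcoef (GaloisField p t) e = (-1) ^ ((∑ i, e (Sum.inr i)) + m) *
      factk p t (fun i => e (Sum.inl i)) * factk p t (fun i => e (Sum.inr i)) := by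
  unfold tcoef factk
  rw [Fintype.prod_sum_type, ← mul_assoc]
  congr 2
  rw [degree_sum] at hdeg
  obtain ⟨r, hr⟩ := hodd
  have h5 : m * (p - 1) = 2 * (m * r) := by rw [hr, Nat.add_sub_cancel]; ring
  apply neg_one_pow_congr
  rw [Nat.even_iff, Nat.even_iff]
  omega

lemma ev_Tt (e : (Fin m ⊕ Fin m) →₀ ℕ) :
    ev (Tt (GaloisField p t) m p (monomial e 1)) = tcoef (GaloisField p t) e •
      mono (abar p (fun i => e (Sum.inr i))) (abar p (fun i => e (Sum.inl i))) := by
  rw [Tt_monomial]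
  have : monomial (tflip p e) (tcoef (GaloisField p t) e)
      = tcoef (GaloisField p t) e • monomial (tflip p e) (1 : GaloisField p t) := by
    rw [smul_monomial, smul_eq_mul, mul_one]
  rw [this, ev_smul, ev_monomial]
  rfl

lemma homog_Tt (e : (Fin m ⊕ Fin m) →₀ ℕ) (hdeg : e.degree = m * (p - 1)) :
    (Tt (GaloisField p t) m p (monomial e 1)).IsHomogeneous (m * (p - 1)) := by
  rw [Tt_monomial]
  by_cases h : ∀ i, e i ≤ p - 1
  · apply isHomogeneous_monomial
    have := degree_tflip e h
    omega
  · push Not at h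
    obtain ⟨i, hi⟩ := h
    rw [tcoef_eq_zero (p := p) (i := i) (by omega)]
    simp [isHomogeneous_zero]

lemma homog_smul {n : ℕ} {F : Pol (GaloisField p t) m} (h : F.IsHomogeneous n)
    (c : GaloisField p t) : (c • F).IsHomogeneous n :=
  (mem_homogeneousSubmodule n _).1 (Submodule.smul_mem _ c ((mem_homogeneousSubmodule n _).2 h))

/-- generators of the space of allowed `j`-th digits -/
def gens (p t m : ℕ) [Fact p.Prime] (n : ℕ) (A : Prop → Prop) : Set (Pol (GaloisField p t) m) :=
  {G | G.IsHomogeneous n ∧ ((∃ e, (∃ i, p ≤ e i) ∧ G = monomial e 1) ∨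
    ∃ pl, A pl ∧ IsDigit p t m n pl (ev G))}

lemma exists_poly (hodd : Odd p) {n : ℕ} {pl : Prop} {g : SympV p t m → GaloisField p t}
    (h : IsDigit p t m n pl g) : ∃ G : Pol (GaloisField p t) m, G.IsHomogeneous n ∧ ev G = g ∧
      (n = m * (p - 1) → Tt (GaloisField p t) m p G = sgn p t pl • G) := by
  rcases h with ⟨hn, _, α, β, hα, hβ, hs, rfl⟩ | ⟨rfl, hpl, α, hα, rfl⟩ |
    ⟨rfl, α, β, hα, hβ, hs, hne, rfl⟩
  · refine ⟨monomial (ex α β) 1, ?_, ev_ex α β, fun h => absurd h hn⟩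
    apply isHomogeneous_monomial
    rw [degree_sum]; exact hs
  · have hr : ∀ i, ex α (abar p α) i ≤ p - 1 := by
      rintro (i | i)
      · exact hα i
      · rw [ex_inr]; unfold abar; omega
    refine ⟨monomial (ex α (abar p α)) 1, ?_, ev_ex _ _, fun _ => ?_⟩
    · apply isHomogeneous_monomial
      rw [degree_sum, ← Finset.sum_add_distrib]
      simp only [ex_inl, ex_inr, abar]
      rw [Finset.sum_congr rfl (fun i _ => Nat.add_sub_cancel' (hα i))]
      simp
    · rw [Tt_monomial, tcoef_self _ hr (fun i => rfl), tflip_self _ hr (fun i => rfl), sgn,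
        if_pos hpl, one_smul]
  · have hr : ∀ i, ex α β i ≤ p - 1 := by
      rintro (i | i)
      · exact hα i
      · exact hβ i
    have hdeg : (ex α β).degree = m * (p - 1) := by rw [degree_sum]; exact hs
    refine ⟨monomial (ex α β) 1 + sgn p t pl • Tt (GaloisField p t) m p (monomial (ex α β) 1),
      ?_, ?_, fun _ => ?_⟩
    · exact (isHomogeneous_monomial _ hdeg).add (homog_smul (homog_Tt _ hdeg) _)
    · rw [ev_add, ev_smul, ev_ex, ev_Tt, smul_smul, tcoef_eq hodd _ hdeg]
      rfl
    · rw [map_add, map_smul, Tt_Tt hodd _ hr, smul_add, smul_smul, sgn_mul, one_smul, add_comm]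

lemma two_ne (hodd : Odd p) : (2 : GaloisField p t) ≠ 0 := by
  have : ((2 : ℕ) : GaloisField p t) ≠ 0 := by
    rw [Ne, CharP.cast_eq_zero_iff (GaloisField p t) p]
    intro h
    have := Nat.le_of_dvd (by norm_num) h
    have := (Fact.out : p.Prime).two_le
    obtain ⟨r, hr⟩ := hodd
    omega
  simpa using this

lemma claim1 (hodd : Odd p) (pl : Prop) (e : (Fin m ⊕ Fin m) →₀ ℕ) (hdeg : e.degree = m * (p - 1)) :
    monomial e 1 + sgn p t pl • Tt (GaloisField p t) m p (monomial e 1) ∈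
      Submodule.span (GaloisField p t) (gens p t m (m * (p - 1)) (fun q => q = pl)) := by
  by_cases hr : ∀ i, e i ≤ p - 1
  · by_cases hs : ∀ i, e (Sum.inr i) = p - 1 - e (Sum.inl i)
    · rw [Tt_monomial, tcoef_self _ hr hs, tflip_self _ hr hs]
      by_cases hpl : pl
      · have : monomial e (1 : GaloisField p t) ∈ gens p t m (m * (p - 1)) (fun q => q = pl) := by
          refine ⟨isHomogeneous_monomial _ hdeg, Or.inr ⟨pl, rfl, Or.inr (Or.inl ⟨rfl, hpl,
            fun i => e (Sum.inl i), fun i => hr _, ?_⟩)⟩⟩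
          rw [ev_monomial]
          congr 1
          funext i
          exact hs i
        exact add_mem (Submodule.subset_span this)
          (Submodule.smul_mem _ _ (Submodule.subset_span this))
      · rw [sgn, if_neg hpl, neg_one_smul, add_neg_cancel]
        exact zero_mem _
    · apply Submodule.subset_span
      refine ⟨(isHomogeneous_monomial _ hdeg).add (homog_smul (homog_Tt _ hdeg) _),
        Or.inr ⟨pl, rfl, Or.inr (Or.inr ⟨rfl, fun i => e (Sum.inl i), fun i => e (Sum.inr i),
          fun i => hr _, fun i => hr _, ?_, ?_, ?_⟩)⟩⟩
      · rw [← degree_sum, hdeg]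
      · intro h
        exact hs fun i => congrFun h i
      · rw [ev_add, ev_smul, ev_monomial, ev_Tt, smul_smul, tcoef_eq hodd _ hdeg]
        rfl
  · push Not at hr
    obtain ⟨i, hi⟩ := hr
    rw [Tt_monomial, tcoef_eq_zero (p := p) (i := i) (by omega), monomial_zero, smul_zero, add_zero]
    exact Submodule.subset_span ⟨isHomogeneous_monomial _ hdeg, Or.inl ⟨e, ⟨i, by omega⟩, rfl⟩⟩

lemma mem_of_monomials {n : ℕ} {M : Submodule (GaloisField p t) (Pol (GaloisField p t) m)}
    (φ : Pol (GaloisField p t) m →ₗ[GaloisField p t] Pol (GaloisField p t) m)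
    {H : Pol (GaloisField p t) m} (hH : H.IsHomogeneous n)
    (h : ∀ e ∈ H.support, e.degree = n → φ (monomial e 1) ∈ M) : φ H ∈ M := by
  rw [← H.support_sum_monomial_coeff, map_sum]
  apply Submodule.sum_mem
  intro e he
  have : monomial e (coeff e H) = coeff e H • monomial e (1 : GaloisField p t) := by
    rw [smul_monomial, smul_eq_mul, mul_one]
  rw [this, map_smul]
  apply Submodule.smul_mem
  apply h e he
  have := hH (mem_support_iff.1 he)
  rwa [Finsupp.degree_eq_weight_one]

lemma claim2 {n : ℕ} {A : Prop → Prop} {H : Pol (GaloisField p t) m} (hH : H.IsHomogeneous n)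
    (hI : H ∈ Ip (GaloisField p t) m p) :
    H ∈ Submodule.span (GaloisField p t) (gens p t m n A) := by
  unfold Ip at hI
  rw [mem_ideal_span_monomial_image] at hI
  refine mem_of_monomials LinearMap.id hH ?_
  intro e he hdeg
  obtain ⟨_, ⟨i, rfl⟩, hle⟩ := hI e he
  refine Submodule.subset_span ⟨isHomogeneous_monomial _ hdeg, Or.inl ⟨e, ⟨i, ?_⟩, rfl⟩⟩
  simpa using hle i

lemma keyspan (hodd : Odd p) (pl : Prop) {H : Pol (GaloisField p t) m}
    (hH : H.IsHomogeneous (m * (p - 1)))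
    (hT : Tt (GaloisField p t) m p H - sgn p t pl • H ∈ Ip (GaloisField p t) m p) :
    H ∈ Submodule.span (GaloisField p t) (gens p t m (m * (p - 1)) (fun q => q = pl)) := by
  have hTH : (Tt (GaloisField p t) m p H).IsHomogeneous (m * (p - 1)) := by
    rw [← mem_homogeneousSubmodule]
    refine mem_of_monomials _ hH ?_
    intro e _ hdeg
    exact homog_Tt e hdeg
  have h1 := claim2 (A := fun q => q = pl) (hTH.sub (homog_smul hH (sgn p t pl))) hT
  have h2 : (LinearMap.id + sgn p t pl • Tt (GaloisField p t) m p :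
      Pol (GaloisField p t) m →ₗ[GaloisField p t] Pol (GaloisField p t) m) H ∈
      Submodule.span (GaloisField p t) (gens p t m (m * (p - 1)) (fun q => q = pl)) := by
    refine mem_of_monomials _ hH ?_
    intro e _ hdeg
    exact claim1 hodd pl e hdeg
  have h3 := Submodule.smul_mem _ (2 : GaloisField p t)⁻¹
    (sub_mem h2 (Submodule.smul_mem _ (sgn p t pl) h1))
  convert! h3 using 1
  have h4 : (LinearMap.id + sgn p t pl • Tt (GaloisField p t) m p :
      Pol (GaloisField p t) m →ₗ[GaloisField p t] Pol (GaloisField p t) m) H -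
      sgn p t pl • (Tt (GaloisField p t) m p H - sgn p t pl • H) = (2 : GaloisField p t) • H := by
    rw [smul_sub, smul_smul, sgn_mul, one_smul, two_smul]
    simp only [LinearMap.add_apply, LinearMap.id_apply, LinearMap.smul_apply]
    abel
  rw [h4, smul_smul, inv_mul_cancel₀ (two_ne hodd), one_smul]

lemma fullspan (hodd : Odd p) {n : ℕ} {A : Prop → Prop} {H : Pol (GaloisField p t) m}
    (hH : H.IsHomogeneous n) (h1 : n ≠ m * (p - 1) → A False) (h2 : n = m * (p - 1) → ∀ q, A q) :
    H ∈ Submodule.span (GaloisField p t) (gens p t m n A) := by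
  refine mem_of_monomials LinearMap.id hH ?_
  intro e _ hdeg
  simp only [LinearMap.id_apply]
  by_cases hn : n = m * (p - 1)
  · subst hn
    have hsub : ∀ pl, gens p t m (m * (p - 1)) (fun q => q = pl) ⊆ gens p t m (m * (p - 1)) A := by
      rintro pl G ⟨hG, h | ⟨q, rfl, h⟩⟩
      · exact ⟨hG, Or.inl h⟩
      · exact ⟨hG, Or.inr ⟨q, h2 rfl q, h⟩⟩
    have a1 := Submodule.span_mono (R := GaloisField p t) (hsub True) (claim1 hodd True e hdeg)
    have a2 := Submodule.span_mono (R := GaloisField p t) (hsub False) (claim1 hodd False e hdeg)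
    have a3 := Submodule.smul_mem _ (2 : GaloisField p t)⁻¹ (add_mem a1 a2)
    convert! a3 using 1
    simp only [sgn, if_true, if_false, one_smul, neg_one_smul]
    rw [add_add_add_comm, add_neg_cancel, add_zero, ← two_smul (GaloisField p t), smul_smul,
      inv_mul_cancel₀ (two_ne hodd), one_smul]
  · apply Submodule.subset_span
    refine ⟨isHomogeneous_monomial _ hdeg, ?_⟩
    by_cases hr : ∀ i, e i ≤ p - 1
    · right
      refine ⟨False, h1 hn, Or.inl ⟨hn, id, fun i => e (Sum.inl i), fun i => e (Sum.inr i),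
        fun i => hr _, fun i => hr _, ?_, ev_monomial e⟩⟩
      rw [← degree_sum, hdeg]
    · left
      push Not at hr
      obtain ⟨i, hi⟩ := hr
      exact ⟨e, ⟨i, by omega⟩, rfl⟩

lemma homog_act (A : Matrix (Fin m ⊕ Fin m) (Fin m ⊕ Fin m) (GaloisField p t)) {n : ℕ}
    {H : Pol (GaloisField p t) m} (hH : H.IsHomogeneous n) : (act A H).IsHomogeneous n := by
  have := hH.aeval (fun l => ∑ j, C (A l j) * X j) (n := 1) (fun l => by
    apply IsHomogeneous.sum
    intro j _
    have := (isHomogeneous_C (Fin m ⊕ Fin m) (A l j)).mul (isHomogeneous_X (GaloisField p t) j)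
    simpa using this)
  simpa [act] using this

lemma act_digit (hodd : Odd p) (A : Matrix (Fin m ⊕ Fin m) (Fin m ⊕ Fin m) (GaloisField p t))
    (hA : A ∈ Matrix.symplecticGroup (Fin m) (GaloisField p t)) (pl : Prop)
    {G : Pol (GaloisField p t) m}
    (hG : G.IsHomogeneous (m * (p - 1))) (hT : Tt (GaloisField p t) m p G = sgn p t pl • G) :
    act A G ∈ Submodule.span (GaloisField p t) (gens p t m (m * (p - 1)) (fun q => q = pl)) := by
  apply keyspan hodd pl (homog_act A hG)
  have := Tt_act (p := p) A hA G
  rwa [hT, map_smul] at this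

lemma digit_le {n : ℕ} {pl : Prop} {g : SympV p t m → GaloisField p t}
    (h : IsDigit p t m n pl g) : n ≤ 2 * m * (p - 1) ∧ (pl → n = m * (p - 1)) := by
  have h2 : m * (p - 1) ≤ 2 * m * (p - 1) := Nat.mul_le_mul_right _ (by omega)
  rcases h with ⟨hn, hpl, α, β, hα, hβ, hs, rfl⟩ | ⟨rfl, hpl, α, hα, rfl⟩ |
    ⟨rfl, α, β, hα, hβ, hs, hne, rfl⟩
  · refine ⟨?_, fun h => absurd h hpl⟩
    have e1 : ∑ i, α i ≤ m * (p - 1) := by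
      simpa using Finset.sum_le_card_nsmul Finset.univ α (p - 1) (fun i _ => hα i)
    have e2 : ∑ i, β i ≤ m * (p - 1) := by
      simpa using Finset.sum_le_card_nsmul Finset.univ β (p - 1) (fun i _ => hβ i)
    rw [mul_assoc]
    omega
  · exact ⟨h2, fun _ => rfl⟩
  · exact ⟨h2, fun _ => rfl⟩

end gal

end YSp

namespace YSp

open MvPolynomial

section fin

variable {p t m : ℕ} [Fact p.Prime]

/-- the function with digits `F j` -/
def Phi (F : Fin t → Pol (GaloisField p t) m) : SympV p t m → GaloisField p t :=
  fun v => ∏ j, (ev (F j) v) ^ (p ^ (j : ℕ))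

lemma Phi_update (F : Fin t → Pol (GaloisField p t) m) (a x) (v) :
    Phi (Function.update F a x) v
      = (ev x v) ^ (p ^ (a : ℕ)) * ∏ j ∈ Finset.univ.erase a, (ev (F j) v) ^ (p ^ (j : ℕ)) := by
  unfold Phi
  rw [← Finset.mul_prod_erase Finset.univ _ (Finset.mem_univ a)]
  congr 1
  · simp
  · apply Finset.prod_congr rfl
    intro j hj
    rw [Function.update_of_ne (Finset.ne_of_mem_erase hj)]

lemma Phi_span (M : Submodule (GaloisField p t) (SympV p t m → GaloisField p t))
    (S : Fin t → Set (Pol (GaloisField p t) m)) (h : ∀ F, (∀ j, F j ∈ S j) → Phi F ∈ M)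
    (F : Fin t → Pol (GaloisField p t) m)
    (hF : ∀ j, F j ∈ Submodule.span (GaloisField p t) (S j)) : Phi F ∈ M := by
  have key : ∀ u : Finset (Fin t), ∀ F : Fin t → Pol (GaloisField p t) m,
      (∀ j ∈ u, F j ∈ Submodule.span (GaloisField p t) (S j)) → (∀ j ∉ u, F j ∈ S j) →
      Phi F ∈ M := by
    intro u
    induction u using Finset.induction_on with
    | empty => intro F _ h2; exact h F fun j => h2 j (by simp)
    | insert a u ha ih =>
      intro F h1 h2
      have hx : ∀ x ∈ Submodule.span (GaloisField p t) (S a), Phi (Function.update F a x) ∈ M := by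
        intro x hx
        induction hx using Submodule.span_induction with
        | mem x hx =>
          apply ih
          · intro j hj
            have : j ≠ a := fun h => ha (h ▸ hj)
            rw [Function.update_of_ne this]
            exact h1 j (Finset.mem_insert_of_mem hj)
          · intro j hj
            by_cases hja : j = a
            · subst hja; simpa using hx
            · rw [Function.update_of_ne hja]
              exact h2 j (by simp [hja, hj])
        | zero =>
          have : Phi (Function.update F a 0) = 0 := by
            funext v
            rw [Phi_update]
            simp [ev, (Fact.out : p.Prime).ne_zero]
          rw [this]; exact zero_mem _
        | add x y _ _ hx hy =>
          have : Phi (Function.update F a (x + y))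
              = Phi (Function.update F a x) + Phi (Function.update F a y) := by
            funext v
            rw [Pi.add_apply, Phi_update, Phi_update, Phi_update, ev_add, Pi.add_apply,
              add_pow_char_pow, add_mul]
          rw [this]; exact add_mem hx hy
        | smul c x _ hx =>
          have : Phi (Function.update F a (c • x))
              = c ^ (p ^ (a : ℕ)) • Phi (Function.update F a x) := by
            funext v
            rw [Pi.smul_apply, Phi_update, Phi_update, ev_smul, Pi.smul_apply, smul_eq_mul,
              smul_eq_mul, mul_pow, mul_assoc]
          rw [this]; exact Submodule.smul_mem _ _ hx
      have := hx (F a) (h1 a (Finset.mem_insert_self _ _))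
      rwa [Function.update_eq_self] at this
  exact key Finset.univ F (fun j _ => hF j) (fun j hj => absurd (Finset.mem_univ j) hj)

lemma digits_max {d : ℕ} (h : ∀ j : Fin t, digitp p d j = p - 1) : p ^ t - 1 ≤ d := by
  have hp := (Fact.out : p.Prime).one_le
  have key : ∀ n, n ≤ t → d % p ^ n = p ^ n - 1 := by
    intro n
    induction n with
    | zero => intro _; simp [Nat.mod_one]
    | succ n ih =>
      intro hn
      have h1 := h ⟨n, hn⟩
      unfold digitp at h1
      simp only at h1
      rw [Nat.mod_pow_succ, ih (by omega), h1, pow_succ]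
      have : 0 < p ^ n := by positivity
      obtain ⟨r, hr⟩ := Nat.exists_eq_add_of_le hp
      obtain ⟨q, hq⟩ := Nat.exists_eq_add_of_le this
      rw [hr] at *
      simp only [Nat.add_sub_cancel_left]
      have : (1 + r) ^ n * (1 + r) = (1 + r) ^ n + (1 + r) ^ n * r := by ring
      omega
  rw [← key t le_rfl]
  exact Nat.mod_le _ _

variable [NeZero t]

lemma val_succ (ht : 1 < t) (j : Fin t) : ((j + 1 : Fin t) : ℕ) = ((j : ℕ) + 1) % t := by
  rw [Fin.val_add, Fin.val_one', Nat.mod_eq_of_lt ht]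

lemma succ_ne (ht : 1 < t) (j : Fin t) : j + 1 ≠ j := by
  intro h
  have h1 := val_succ ht j
  rw [h] at h1
  have := j.isLt
  by_cases h2 : (j : ℕ) + 1 < t
  · rw [Nat.mod_eq_of_lt h2] at h1; omega
  · have h3 : (j : ℕ) + 1 = t := by omega
    rw [h3, Nat.mod_self] at h1; omega

lemma succ_inj {i j : Fin t} (h : i + 1 = j + 1) : i = j := add_right_cancel h

lemma pow_next (ht : 1 < t) (j : Fin t) (x : GaloisField p t) :
    (x ^ p) ^ (p ^ (j : ℕ)) = x ^ (p ^ ((j + 1 : Fin t) : ℕ)) := by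
  rw [val_succ ht, ← pow_mul, ← pow_succ']
  by_cases h2 : (j : ℕ) + 1 < t
  · rw [Nat.mod_eq_of_lt h2]
  · have h3 : (j : ℕ) + 1 = t := by have := j.isLt; omega
    rw [h3, Nat.mod_self, pow_zero, pow_one]
    have : Fintype (GaloisField p t) := Fintype.ofFinite _
    have hc : Fintype.card (GaloisField p t) = p ^ t := by
      rw [← Nat.card_eq_fintype_card, GaloisField.card p t (by omega)]
    rw [← hc]
    exact FiniteField.pow_card x

lemma Phi_carry (ht : 1 < t) (F : Fin t → Pol (GaloisField p t) m) (j : Fin t)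
    (e : (Fin m ⊕ Fin m) →₀ ℕ) (i) (hi : p ≤ e i) (hF : F j = monomial e 1) :
    Phi F = Phi (Function.update (Function.update F j (monomial (e - Finsupp.single i p) 1))
      (j + 1) (X i * F (j + 1))) := by
  funext v
  have hne := succ_ne ht j
  have hm : j ∈ Finset.univ.erase (j + 1) := Finset.mem_erase.2 ⟨hne.symm, Finset.mem_univ _⟩
  rw [Phi_update]
  unfold Phi
  rw [← Finset.mul_prod_erase Finset.univ _ (Finset.mem_univ (j + 1)),
    ← Finset.mul_prod_erase _ _ hm, ← Finset.mul_prod_erase _ _ hm, Function.update_self]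
  have e1 : ∏ x ∈ (Finset.univ.erase (j + 1)).erase j,
      ev (Function.update F j (monomial (e - Finsupp.single i p) 1) x) v ^ p ^ (x : ℕ)
      = ∏ x ∈ (Finset.univ.erase (j + 1)).erase j, ev (F x) v ^ p ^ (x : ℕ) := by
    apply Finset.prod_congr rfl
    intro x hx
    rw [Function.update_of_ne (Finset.ne_of_mem_erase hx)]
  rw [e1]
  have e2 : F j = monomial (e - Finsupp.single i p) 1 * X i ^ p := by
    rw [hF, X_pow_eq_monomial, monomial_mul, mul_one, tsub_add_cancel_of_le]
    simpa using hi
  have e3 : ev (F j) v = ev (monomial (e - Finsupp.single i p) 1) v * ev (X i) v ^ p := by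
    rw [e2]; simp only [ev, map_mul, map_pow]
  have e4 : ev (X i * F (j + 1)) v = ev (X i) v * ev (F (j + 1)) v := by
    simp only [ev, map_mul]
  rw [e3, e4, mul_pow, mul_pow, pow_next ht]
  ring

lemma cyc (ht : 1 < t) (P : Fin t → Prop) (h : ∀ j, P (j + 1) → P j) (j0 : Fin t) (h0 : P j0) :
    ∀ j, P j := by
  have key : ∀ n : ℕ, ∀ j : Fin t, (j0 : ℕ) = ((j : ℕ) + n) % t → P j := by
    intro n
    induction n with
    | zero =>
      intro j hj
      rw [add_zero, Nat.mod_eq_of_lt j.isLt] at hj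
      rwa [← Fin.ext hj]
    | succ n ih =>
      intro j hj
      apply h
      apply ih
      rw [hj, val_succ ht, Nat.mod_add_mod]
      congr 1
      ring
  intro j
  apply key (j0 + t - j)
  have := j.isLt
  rw [show (j : ℕ) + (j0 + t - j) = j0 + t by omega, Nat.add_mod_right, Nat.mod_eq_of_lt j0.isLt]

lemma low {d : ℕ} (ht : 1 < t) (hd : d ≤ p ^ t - 2) (s : Fin t → ℤ)
    (hs : ∀ j, 0 ≤ lamOf p t d s j) :
    (∀ j, 0 ≤ s j) ∧ (d = 0 → (∃ j, s j = 0) → ∀ j, s j = 0) := by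
  have hp := (Fact.out : p.Prime).two_le
  have hdig : ∀ j : Fin t, digitp p d j ≤ p - 1 := by
    intro j
    have := Nat.mod_lt (d / p ^ (j : ℕ)) (show 0 < p by omega)
    unfold digitp; omega
  have h1 : ∀ j, 0 ≤ s j := by
    obtain ⟨j0, hj0⟩ := Finite.exists_min s
    by_contra hcon
    push Not at hcon
    obtain ⟨j1, hj1⟩ := hcon
    have hneg : s j0 < 0 := lt_of_le_of_lt (hj0 j1) hj1
    have hm1 : -1 ≤ s j0 := by
      have a1 := hs (j0 - 1)
      unfold lamOf at a1
      rw [sub_add_cancel] at a1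
      have a2 := hj0 (j0 - 1)
      have a3 : ((digitp p d ((j0 - 1 : Fin t) : ℕ) : ℕ) : ℤ) ≤ p - 1 := by
        have := hdig (j0 - 1); omega
      have hp' : (2 : ℤ) ≤ p := by exact_mod_cast hp
      nlinarith
    have hmin : ∀ j, -1 ≤ s j := fun j => hm1.trans (hj0 j)
    have step : ∀ j, s (j + 1) = -1 → s j = -1 ∧ digitp p d j = p - 1 := by
      intro j hj
      have a1 := hs j
      unfold lamOf at a1
      rw [hj] at a1
      have a2 := hmin j
      have a3 := hdig j
      constructor <;> omega
    have all := cyc ht (fun j => s j = -1) (fun j h => (step j h).1) j0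
      (by have := hm1; omega)
    have := digits_max (p := p) (t := t) (d := d) (fun j => (step j (all _)).2)
    have : 2 ≤ p ^ t := hp.trans (Nat.le_self_pow (by omega) p)
    omega
  refine ⟨h1, ?_⟩
  rintro rfl ⟨j0, hj0⟩
  apply cyc ht (fun j => s j = 0) _ j0 hj0
  intro j hj
  have a1 := hs j
  unfold lamOf at a1
  rw [hj] at a1
  have : digitp p 0 j = 0 := by simp [digitp]
  have := h1 j
  omega

/-- allowed signs at position `j` -/
def Al (p t m d : ℕ) [NeZero t] (s : Fin t → ℤ) (eps : Finset (Fin t)) (s' : Fin t → ℤ)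
    (j : Fin t) (q : Prop) : Prop := j ∈ Zset p t m d s' s → (q ↔ j ∈ eps)

lemma main_ind {d : ℕ} (hodd : Odd p) (ht : 1 < t) (hd : d ≤ p ^ t - 2)
    (s : Fin t → ℤ) (eps : Finset (Fin t)) (hsup : ∀ j, s j ≤ 2 * m - 1) :
    ∀ N : ℕ, ∀ s' : Fin t → ℤ, (∑ j, s' j).toNat = N → (∀ j, s' j ≤ s j) →
      (∀ j, 0 ≤ lamOf p t d s' j) → (d = 0 → ∀ j, 1 ≤ s' j) →
      ∀ F : Fin t → Pol (GaloisField p t) m,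
      (∀ j, F j ∈ Submodule.span (GaloisField p t)
        (gens p t m (lamOfN p t d s' j) (Al p t m d s eps s' j))) →
      Phi F ∈ Ymod p t m d s eps := by
  intro N
  induction N using Nat.strong_induction_on with
  | _ N IH =>
  intro s' hN hle hlam hd0 F hF
  refine Phi_span _ _ ?_ F hF
  clear hF F
  intro F hF
  have hp := (Fact.out : p.Prime).two_le
  have hpc : ((p - 1 : ℕ) : ℤ) = (p : ℤ) - 1 := by push_cast [Nat.cast_sub (show 1 ≤ p by omega)]; rfl
  have hlamN : ∀ j, ((lamOfN p t d s' j : ℕ) : ℤ) = lamOf p t d s' j := fun j =>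
    Int.toNat_of_nonneg (hlam j)
  by_cases hall : ∃ (j : Fin t) (e : (Fin m ⊕ Fin m) →₀ ℕ) (i : Fin m ⊕ Fin m),
      p ≤ e i ∧ F j = monomial e 1
  · obtain ⟨j, e, i, hi, hFj⟩ := hall
    have hdeg : e.degree = lamOfN p t d s' j := by
      have h1 := (hF j).1
      rw [hFj] at h1
      have h2 := h1 (d := e) (by simp)
      rwa [Finsupp.degree_eq_weight_one]
    have hpl : p ≤ lamOfN p t d s' j := by
      rw [← hdeg]
      exact hi.trans (Finsupp.le_degree i e)
    have hne := succ_ne ht j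
    set s2 : Fin t → ℤ := Function.update s' (j + 1) (s' (j + 1) - 1) with hs2
    have hs2self : s2 (j + 1) = s' (j + 1) - 1 := by simp [hs2]
    have hs2ne : ∀ l, l ≠ j + 1 → s2 l = s' l := fun l hl => by
      rw [hs2, Function.update_of_ne hl]
    have l1 : lamOf p t d s2 j = lamOf p t d s' j - p := by
      unfold lamOf
      rw [hs2self, hs2ne j hne.symm]; ring
    have l2 : lamOf p t d s2 (j + 1) = lamOf p t d s' (j + 1) + 1 := by
      unfold lamOf
      rw [hs2self, hs2ne (j + 1 + 1) (succ_ne ht (j + 1))]; ring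
    have l3 : ∀ l, l ≠ j → l ≠ j + 1 → lamOf p t d s2 l = lamOf p t d s' l := by
      intro l h1 h2
      unfold lamOf
      rw [hs2ne l h2, hs2ne (l + 1) (fun h => h1 (succ_inj h))]
    have hlam2 : ∀ l, 0 ≤ lamOf p t d s2 l := by
      intro l
      by_cases h1 : l = j
      · subst h1
        rw [l1, ← hlamN]
        omega
      · by_cases h2 : l = j + 1
        · subst h2
          rw [l2]; have := hlam (j + 1); omega
        · rw [l3 l h1 h2]; exact hlam l
    obtain ⟨lo1, lo2⟩ := low ht hd s2 hlam2
    have hle2 : ∀ l, s2 l ≤ s l := by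
      intro l
      by_cases h2 : l = j + 1
      · subst h2
        rw [hs2self]; have := hle (j + 1); omega
      · rw [hs2ne l h2]; exact hle l
    have hsum : ∑ l, s2 l = ∑ l, s' l - 1 := by
      rw [← Finset.add_sum_erase Finset.univ s2 (Finset.mem_univ (j + 1)),
        ← Finset.add_sum_erase Finset.univ s' (Finset.mem_univ (j + 1)), hs2self,
        Finset.sum_congr rfl (fun l hl => hs2ne l (Finset.ne_of_mem_erase hl))]
      ring
    have hsum0 : 0 ≤ ∑ l, s2 l := Finset.sum_nonneg fun l _ => lo1 l
    have hZ1 : j ∉ Zset p t m d s2 s := by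
      unfold Zset
      simp only [Finset.mem_filter, not_and]
      intro _ _ h
      have := hle (j + 1)
      omega
    have hZ2 : j + 1 ∉ Zset p t m d s2 s := by
      unfold Zset
      simp only [Finset.mem_filter, not_and]
      intro _ h
      have := hle (j + 1)
      omega
    have hd2 : d = 0 → ∀ l, 1 ≤ s2 l := by
      intro hdz l
      by_contra hc
      have hl0 : s2 l = 0 := by have := lo1 l; omega
      have hz := lo2 hdz ⟨l, hl0⟩
      have : lamOf p t d s2 (j + 1) = 0 := by
        unfold lamOf
        rw [hz, hz, hdz]; simp [digitp]
      have := hlam (j + 1)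
      omega
    rw [Phi_carry ht F j e i hi hFj]
    refine IH (∑ l, s2 l).toNat (by omega) s2 rfl hle2 hlam2 hd2 _ ?_
    intro l
    by_cases h2 : l = j + 1
    · subst h2
      rw [Function.update_self]
      refine fullspan hodd ?_ (fun _ h => absurd h hZ2) (fun _ q h => absurd h hZ2)
      have := (isHomogeneous_X (GaloisField p t) i).mul (hF (j + 1)).1
      convert! this using 1
      unfold lamOfN
      rw [l2]; have := hlam (j + 1); omega
    · rw [Function.update_of_ne h2]
      by_cases h1 : l = j
      · subst h1
        rw [Function.update_self]
        refine fullspan hodd ?_ (fun _ h => absurd h hZ1) (fun _ q h => absurd h hZ1)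
        apply isHomogeneous_monomial
        have h3 : (e - Finsupp.single i p).degree + p = e.degree := by
          have : e - Finsupp.single i p + Finsupp.single i p = e :=
            tsub_add_cancel_of_le (by simpa using hi)
          conv_rhs => rw [← this, map_add, Finsupp.degree_single]
        have h4 : lamOfN p t d s2 l = (lamOf p t d s' l - p).toNat := by rw [lamOfN, l1]
        have h5 : lamOfN p t d s' l = (lamOf p t d s' l).toNat := rfl
        omega
      · rw [Function.update_of_ne h1]
        apply Submodule.subset_span
        have e1 : lamOfN p t d s2 l = lamOfN p t d s' l := by
          unfold lamOfN; rw [l3 l h1 h2]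
        have e2 : Al p t m d s eps s2 l = Al p t m d s eps s' l := by
          funext q
          unfold Al Zset
          simp only [Finset.mem_filter, l3 l h1 h2, hs2ne l h2,
            hs2ne (l + 1) (fun h => h1 (succ_inj h))]
        rw [e1, e2]
        exact hF l
  · have hch : ∀ j, ∃ q, Al p t m d s eps s' j q ∧
        IsDigit p t m (lamOfN p t d s' j) q (ev (F j)) := by
      intro j
      rcases (hF j).2 with ⟨e, ⟨i, hi⟩, he⟩ | h
      · exact absurd ⟨j, e, i, hi, he⟩ hall
      · exact h
    choose q hq1 hq2 using hch
    apply Submodule.subset_span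
    have hub : ∀ j, lamOf p t d s' j ≤ 2 * m * ((p : ℤ) - 1) := by
      intro j
      rw [← hlamN, ← hpc]
      exact_mod_cast (digit_le (hq2 j)).1
    have hJ : Finset.univ.filter q ⊆ Jset p t m d s' := by
      intro j hj
      unfold Jset
      simp only [Finset.mem_filter, Finset.mem_univ, true_and] at hj ⊢
      rw [← hlamN, ← hpc]
      exact_mod_cast (digit_le (hq2 j)).2 hj
    refine ⟨s', Finset.univ.filter q, ?_, ⟨hle, ?_⟩, fun j => ev (F j), ?_, rfl⟩
    · unfold memCase
      split_ifs with h
      · subst h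
        exact ⟨⟨fun j => ⟨hd0 rfl j, (hle j).trans (hsup j)⟩, fun j => ⟨hlam j, hub j⟩⟩, hJ⟩
      · exact ⟨⟨fun j => ⟨(low ht hd s' hlam).1 j, (hle j).trans (hsup j)⟩,
          fun j => ⟨hlam j, hub j⟩⟩, hJ⟩
    · ext j
      simp only [Finset.mem_inter, Finset.mem_filter, Finset.mem_univ, true_and]
      constructor
      · rintro ⟨h1, h2⟩; exact ⟨(hq1 j h2).2 h1, h2⟩
      · rintro ⟨h1, h2⟩; exact ⟨(hq1 j h2).1 h1, h2⟩
    · intro j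
      have : (j ∈ Finset.univ.filter q) = q j := by simp
      rw [this]
      exact hq2 j

lemma exists_matrix (g : SympV p t m ≃ₗ[GaloisField p t] SympV p t m) (hg : IsSymp g) :
    ∃ A ∈ Matrix.symplecticGroup (Fin m) (GaloisField p t),
      ∀ (G : Pol (GaloisField p t) m) (v), ev (act A G) v = ev G (g.symm v) := by
  let c : SympV p t m ≃ₗ[GaloisField p t] (Fin m ⊕ Fin m → GaloisField p t) :=
    (LinearEquiv.sumArrowLequivProdArrow (Fin m) (Fin m) (GaloisField p t) (GaloisField p t)).symm
  have hc : ∀ v : SympV p t m, c v = Sum.elim v.1 v.2 := by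
    intro v
    funext i
    rcases i with i | i <;> rfl
  let A := LinearMap.toMatrix' ((c.toLinearMap ∘ₗ g.symm.toLinearMap) ∘ₗ c.symm.toLinearMap)
  have hA : ∀ v, A.mulVec (c v) = c (g.symm v) := by
    intro v
    rw [← Matrix.toLin'_apply, Matrix.toLin'_toMatrix']
    simp
  have hform : ∀ v w : SympV p t m,
      dotProduct (c v) ((Matrix.J (Fin m) (GaloisField p t)).mulVec (c w)) = - sform v w := by
    intro v w
    rw [hc, hc, Matrix.J, Matrix.fromBlocks_mulVec]
    simp [dotProduct, sform, Finset.sum_sub_distrib, Matrix.neg_mulVec]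
    ring
  refine ⟨A, ?_, ?_⟩
  · rw [SymplecticGroup.mem_iff']
    have hb : ∀ u w, dotProduct u ((A.transpose * Matrix.J (Fin m) (GaloisField p t) * A).mulVec w)
        = dotProduct u ((Matrix.J (Fin m) (GaloisField p t)).mulVec w) := by
      intro u w
      obtain ⟨v, rfl⟩ := c.surjective u
      obtain ⟨w, rfl⟩ := c.surjective w
      rw [← Matrix.mulVec_mulVec, ← Matrix.mulVec_mulVec, Matrix.dotProduct_mulVec,
        Matrix.vecMul_transpose, hA, hA, hform, hform]
      have := hg (g.symm v) (g.symm w)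
      rw [LinearEquiv.apply_symm_apply, LinearEquiv.apply_symm_apply] at this
      rw [this]
    ext i j
    have := hb (Pi.single i 1) (Pi.single j 1)
    simpa using this
  · intro G v
    have h : (aeval (Sum.elim v.1 v.2)).comp (act A) = (aeval (Sum.elim (g.symm v).1 (g.symm v).2) :
        Pol (GaloisField p t) m →ₐ[GaloisField p t] GaloisField p t) := by
      apply MvPolynomial.algHom_ext
      intro l
      have h1 := congrFun (hA v) l
      rw [hc, hc] at h1
      rw [AlgHom.comp_apply, act_X, aeval_X, ← h1, map_sum]
      simp only [map_mul, aeval_X, aeval_C, Matrix.mulVec, dotProduct, Algebra.algebraMap_self,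
        RingHom.id_apply]
    have := AlgHom.congr_fun h G
    rw [AlgHom.comp_apply] at this
    have h0 : ∀ (x : Fin m ⊕ Fin m → GaloisField p t) (F : Pol (GaloisField p t) m),
        aeval x F = eval x F := fun x F => by rw [← coe_aeval_eq_eval]; rfl
    rw [h0, h0] at this
    exact this

lemma case_facts {d : ℕ} {s : Fin t → ℤ} {eps : Finset (Fin t)} (h : memCase p t m d s eps) :
    (∀ j, s j ≤ 2 * m - 1) ∧ (∀ j, 0 ≤ lamOf p t d s j) ∧ (d = 0 → ∀ j, 1 ≤ s j) := by
  unfold memCase at h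
  split_ifs at h with hd
  · subst hd
    exact ⟨fun j => (h.1.1 j).2, fun j => (h.1.2 j).1, fun _ j => (h.1.1 j).1⟩
  · exact ⟨fun j => (h.1.1 j).2, fun j => (h.1.2 j).1, fun h0 => absurd h0 hd⟩

lemma final {d : ℕ} (hodd : Odd p) (ht : 1 < t) (hd : d ≤ p ^ t - 2)
    (s : Fin t → ℤ) (eps : Finset (Fin t)) (hmem : memCase p t m d s eps) :
    SpStable (Ymod p t m d s eps) := by
  intro g hg h hh
  obtain ⟨A, hA, hev⟩ := exists_matrix g hg
  unfold Ymod at hh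
  induction hh using Submodule.span_induction with
  | zero => exact zero_mem _
  | add x y _ _ hx hy => exact add_mem hx hy
  | smul c x _ hx => exact Submodule.smul_mem _ c hx
  | mem f hf =>
    obtain ⟨s', eps', hm', ⟨hle, heps⟩, dg, hdg, rfl⟩ := hf
    obtain ⟨_, hlam, hd0⟩ := case_facts hm'
    choose G hG1 hG2 hG3 using fun j => exists_poly hodd (hdg j)
    have e1 : (fun v => (fun v => ∏ j, (dg j v) ^ (p ^ (j : ℕ))) (g.symm v))
        = Phi (fun j => act A (G j)) := by
      funext v
      unfold Phi
      simp only [hev, hG2]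
    rw [e1]
    refine main_ind hodd ht hd s eps (case_facts hmem).1 _ s' rfl hle hlam hd0 _ ?_
    intro j
    by_cases hj : lamOfN p t d s' j = m * (p - 1)
    · have h1 := hG1 j
      rw [hj] at h1 ⊢
      have h2 := act_digit hodd A hA _ h1 (hG3 j hj)
      refine Submodule.span_mono ?_ h2
      rintro x ⟨hx, h | ⟨q, rfl, h⟩⟩
      · exact ⟨hx, Or.inl h⟩
      · refine ⟨hx, Or.inr ⟨_, ?_, h⟩⟩
        intro hz
        have := Finset.ext_iff.1 heps j
        simp only [Finset.mem_inter, hz, and_true] at this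
        exact this.symm
    · have hz : j ∉ Zset p t m d s' s := by
        unfold Zset
        simp only [Finset.mem_filter, not_and]
        intro _ _ _ h
        apply hj
        have hp := (Fact.out : p.Prime).two_le
        have hpc : ((p - 1 : ℕ) : ℤ) = (p : ℤ) - 1 := by
          push_cast [Nat.cast_sub (show 1 ≤ p by omega)]; rfl
        unfold lamOfN
        rw [h, ← hpc, ← Nat.cast_mul, Int.toNat_natCast]
      exact fullspan hodd (homog_act A (hG1 j)) (fun _ h => absurd h hz) (fun h => absurd h hj)

end fin

end YSp


/-- `Y(s,ε)[d]` (resp. `Y(s,ε)` when `d = 0`) is stable under the action of `Sp(V)`: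
for `g ∈ Sp(V)` and `h ∈ Y(s,ε)[d]`, the function `v ↦ h(g⁻¹v)` again lies in it. -/
theorem Y_spstable (p t m d : ℕ) [Fact p.Prime] [NeZero t]
    (hodd : Odd p) (ht : 1 < t) (hm : 2 ≤ m) (hd : d ≤ p ^ t - 2)
    (s : Fin t → ℤ) (eps : Finset (Fin t))
    (hmem : memCase p t m d s eps) :
    SpStable (Ymod p t m d s eps) := by
  exact YSp.final hodd ht hd s eps hmem

end
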